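/- Let k ≥ 1, R > 0 and r ∈ [0, R). If ζ : B_{R,r} → ℝ^k is a smooth function such that the closure in ℝ² of its support {z ∈ B_{R,r} : ζ(z) ≠ 0} is contained in B_R \ B_r (i.e. this closure is disjoint from the circle |z| = R), then ‖ζ‖₂ ≤ ‖dζ‖₁, where both norms are taken over B_{R,r}. -/

import Mathlib

open MeasureTheory Real

/-- The open annulus `B_{R,r} = B_R \ closure(B_r)` in the Euclidean plane. -/
noncomputable def annulus (R r : ℝ) : Set (EuclideanSpace ℝ (Fin 2)) :=
  Metric.ball 0 R \ closure (Metric.ball 0 r)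

section AnnulusSobolev

variable {E F : Type*} [NormedAddCommGroup E] [NormedSpace ℝ E]
  [NormedAddCommGroup F] [NormedSpace ℝ F]

/-- A function that is `C¹` along a ray and vanishes far out on it is bounded at the origin of the
ray by the integral of its derivative. -/
lemma enorm_le_lintegral_enorm_fderiv_ray [CompleteSpace F] {f : E → F} {z v : E} (hv : ‖v‖ ≤ 1)
    (hf : ∀ t : ℝ, 0 ≤ t → ContDiffAt ℝ 1 f (z + t • v)) {b : ℝ} (hb : 0 ≤ b)
    (hfb : f (z + b • v) = 0) :
    ‖f z‖ₑ ≤ ∫⁻ t in Set.Ioi (0 : ℝ), ‖fderiv ℝ f (z + t • v)‖ₑ := by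
  have hderiv : ∀ t ∈ Set.uIcc 0 b,
      HasDerivAt (fun t : ℝ => f (z + t • v)) (fderiv ℝ f (z + t • v) v) t := by
    intro t ht
    rw [Set.uIcc_of_le hb] at ht
    have h1 : HasDerivAt (fun t : ℝ => z + t • v) v t := by
      simpa using ((hasDerivAt_id t).smul_const v).const_add z
    exact ((hf t ht.1).differentiableAt (by simp)).hasFDerivAt.comp_hasDerivAt t h1
  have hcont : ContinuousOn (fun t : ℝ => fderiv ℝ f (z + t • v) v) (Set.uIcc 0 b) := by
    intro t ht
    rw [Set.uIcc_of_le hb] at ht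
    have h1 : ContinuousAt (fderiv ℝ f) (z + t • v) :=
      ((hf t ht.1).fderiv_right (m := 0) (by simp)).continuousAt
    have h2 : ContinuousAt (fun t : ℝ => fderiv ℝ f (z + t • v)) t :=
      ContinuousAt.comp (f := fun t : ℝ => z + t • v) h1 (by fun_prop)
    exact (h2.clm_apply continuousAt_const).continuousWithinAt
  have hint := intervalIntegral.integral_eq_sub_of_hasDerivAt hderiv hcont.intervalIntegrable
  rw [hfb, zero_smul, add_zero, zero_sub, intervalIntegral.integral_of_le hb] at hint
  calc ‖f z‖ₑ = ‖∫ t in Set.Ioc 0 b, fderiv ℝ f (z + t • v) v‖ₑ := by rw [hint, enorm_neg]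
    _ ≤ ∫⁻ t in Set.Ioc 0 b, ‖fderiv ℝ f (z + t • v) v‖ₑ := enorm_integral_le_lintegral_enorm _
    _ ≤ ∫⁻ t in Set.Ioc 0 b, ‖fderiv ℝ f (z + t • v)‖ₑ := by
      refine lintegral_mono fun t => ?_
      rw [enorm_le_iff_norm_le]
      exact (ContinuousLinearMap.le_opNorm _ _).trans
        (mul_le_of_le_one_right (norm_nonneg _) hv)
    _ ≤ ∫⁻ t in Set.Ioi (0 : ℝ), ‖fderiv ℝ f (z + t • v)‖ₑ :=
      lintegral_mono_set Set.Ioc_subset_Ioi_self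

lemma notMem_closure_ball_of_norm_le {r : ℝ} {z w : E}
    (hz : z ∉ closure (Metric.ball (0 : E) r)) (h : ‖z‖ ≤ ‖w‖) :
    w ∉ closure (Metric.ball (0 : E) r) := by
  rcases eq_or_ne r 0 with rfl | hr
  · simp
  · rw [closure_ball _ hr, mem_closedBall_zero_iff] at hz ⊢
    exact fun hw => hz (h.trans hw)

end AnnulusSobolev

lemma isOpen_annulus (R r : ℝ) : IsOpen (annulus R r) :=
  Metric.isOpen_ball.sdiff isClosed_closure

section Extension

variable {F : Type*} [NormedAddCommGroup F] {R r : ℝ}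
  {ζ : EuclideanSpace ℝ (Fin 2) → F}

lemma indicator_annulus_eventuallyEq_zero
    (hsupp : closure {z | z ∈ annulus R r ∧ ζ z ≠ 0} ⊆ Metric.ball 0 R \ Metric.ball 0 r)
    {z : EuclideanSpace ℝ (Fin 2)} (hz : z ∉ Metric.ball 0 R) :
    (annulus R r).indicator ζ =ᶠ[nhds z] 0 := by
  have hz' : z ∉ closure {z | z ∈ annulus R r ∧ ζ z ≠ 0} := fun h => hz (hsupp h).1
  filter_upwards [isClosed_closure.isOpen_compl.mem_nhds hz'] with w hw
  by_contra hne
  exact hw (subset_closure ⟨Set.mem_of_indicator_ne_zero hne,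
    fun h => hne (by simp [h])⟩)

lemma indicator_annulus_eventuallyEq_self {z : EuclideanSpace ℝ (Fin 2)} (hz : z ∈ annulus R r) :
    (annulus R r).indicator ζ =ᶠ[nhds z] ζ := by
  filter_upwards [(isOpen_annulus R r).mem_nhds hz] with w hw
  exact Set.indicator_of_mem hw ζ

variable [NormedSpace ℝ F]

lemma contDiffAt_indicator_annulus (hζ : ContDiffOn ℝ (⊤ : ℕ∞) ζ (annulus R r))
    (hsupp : closure {z | z ∈ annulus R r ∧ ζ z ≠ 0} ⊆ Metric.ball 0 R \ Metric.ball 0 r)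
    {z : EuclideanSpace ℝ (Fin 2)} (hz : z ∉ closure (Metric.ball 0 r)) :
    ContDiffAt ℝ 1 ((annulus R r).indicator ζ) z := by
  by_cases hR : z ∈ Metric.ball 0 R
  · have hzA : z ∈ annulus R r := ⟨hR, hz⟩
    exact ((hζ.contDiffAt ((isOpen_annulus R r).mem_nhds hzA)).of_le
      (by exact_mod_cast le_top)).congr_of_eventuallyEq (indicator_annulus_eventuallyEq_self hzA)
  · exact contDiffAt_const.congr_of_eventuallyEq (indicator_annulus_eventuallyEq_zero hsupp hR)

lemma enorm_fderiv_indicator_annulus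
    (hsupp : closure {z | z ∈ annulus R r ∧ ζ z ≠ 0} ⊆ Metric.ball 0 R \ Metric.ball 0 r)
    {z : EuclideanSpace ℝ (Fin 2)} (hz : z ∉ closure (Metric.ball 0 r)) :
    ‖fderiv ℝ ((annulus R r).indicator ζ) z‖ₑ =
      (annulus R r).indicator (fun y => ‖fderiv ℝ ζ y‖ₑ) z := by
  by_cases hR : z ∈ Metric.ball 0 R
  · have hzA : z ∈ annulus R r := ⟨hR, hz⟩
    rw [Set.indicator_of_mem hzA, (indicator_annulus_eventuallyEq_self hzA).fderiv_eq]
  · have hzA : z ∉ annulus R r := fun h => hR h.1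
    rw [Set.indicator_of_notMem hzA, (indicator_annulus_eventuallyEq_zero hsupp hR).fderiv_eq,
      fderiv_zero]
    exact enorm_zero (E := EuclideanSpace ℝ (Fin 2) →L[ℝ] F)

/-- Along a ray pointing away from the origin, `ζ` is controlled by the integral of `‖dζ‖`. -/
lemma enorm_le_lintegral_ray [CompleteSpace F] (hζ : ContDiffOn ℝ (⊤ : ℕ∞) ζ (annulus R r))
    (hsupp : closure {z | z ∈ annulus R r ∧ ζ z ≠ 0} ⊆ Metric.ball 0 R \ Metric.ball 0 r)
    {z v : EuclideanSpace ℝ (Fin 2)} (hz : z ∈ annulus R r) (hv : ‖v‖ = 1)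
    (hzv : 0 ≤ inner ℝ z v) :
    ‖ζ z‖ₑ ≤ ∫⁻ t in Set.Ioi (0 : ℝ),
      (annulus R r).indicator (fun y => ‖fderiv ℝ ζ y‖ₑ) (z + t • v) := by
  have hsq (t : ℝ) : ‖z + t • v‖ ^ 2 = ‖z‖ ^ 2 + 2 * (t * inner ℝ z v) + t ^ 2 := by
    rw [norm_add_sq_real, inner_smul_right, norm_smul, hv, mul_one, Real.norm_eq_abs, sq_abs]
  have hray (t : ℝ) (ht : 0 ≤ t) : z + t • v ∉ closure (Metric.ball 0 r) := by
    refine notMem_closure_ball_of_norm_le hz.2 ?_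
    refine le_of_sq_le_sq ?_ (norm_nonneg _)
    rw [hsq]
    nlinarith [mul_nonneg ht hzv, sq_nonneg t]
  have hR : 0 ≤ R := (norm_nonneg z).trans (mem_ball_zero_iff.1 hz.1).le
  have hfar : z + R • v ∉ annulus R r := by
    intro h
    have h1 := mem_ball_zero_iff.1 h.1
    have h2 := hsq R
    nlinarith [mul_nonneg hR hzv, sq_nonneg ‖z‖, norm_nonneg (z + R • v)]
  have key := enorm_le_lintegral_enorm_fderiv_ray (f := (annulus R r).indicator ζ) hv.le
    (fun t ht => contDiffAt_indicator_annulus hζ hsupp (hray t ht)) hR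
    (Set.indicator_of_notMem hfar ζ)
  rw [Set.indicator_of_mem hz] at key
  refine key.trans_eq (setLIntegral_congr_fun measurableSet_Ioi fun t ht => ?_)
  exact enorm_fderiv_indicator_annulus hsupp (hray t (le_of_lt ht))

/-- On the full coordinate line through `z`, one of the two half-lines points away from the
origin. -/
lemma enorm_le_lintegral_line [CompleteSpace F] (hζ : ContDiffOn ℝ (⊤ : ℕ∞) ζ (annulus R r))
    (hsupp : closure {z | z ∈ annulus R r ∧ ζ z ≠ 0} ⊆ Metric.ball 0 R \ Metric.ball 0 r)
    {z v : EuclideanSpace ℝ (Fin 2)} (hz : z ∈ annulus R r) (hv : ‖v‖ = 1) :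
    ‖ζ z‖ₑ ≤ ∫⁻ t : ℝ, (annulus R r).indicator (fun y => ‖fderiv ℝ ζ y‖ₑ) (z + t • v) := by
  rcases le_total 0 (inner ℝ z v) with h | h
  · exact (enorm_le_lintegral_ray hζ hsupp hz hv h).trans (setLIntegral_le_lintegral _ _)
  · have hneg := enorm_le_lintegral_ray hζ hsupp hz (v := -v) (by rwa [norm_neg])
      (by rw [inner_neg_right]; linarith)
    refine (hneg.trans (setLIntegral_le_lintegral _ _)).trans_eq ?_
    rw [← lintegral_neg_eq_self]
    simp

end Extension

lemma lintegral_euclideanSpace_fin_two (f : EuclideanSpace ℝ (Fin 2) → ENNReal) :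
    ∫⁻ z, f z = ∫⁻ p : ℝ × ℝ, f !₂[p.1, p.2] := by
  have h := (volume_preserving_finTwoArrow ℝ).comp
    (EuclideanSpace.volume_preserving_symm_measurableEquiv_toLp (Fin 2))
  have h2 := h.symm (((MeasurableEquiv.toLp 2 (Fin 2 → ℝ)).symm).trans
    (MeasurableEquiv.finTwoArrow (α := ℝ)))
  rw [← h2.lintegral_comp_emb (MeasurableEquiv.measurableEmbedding _)]
  rfl

/-- **An L² Poincaré-type inequality.** If `ζ : B_{R,r} → ℝ^k` is smooth and the closure in
`ℝ²` of its support is contained in `B_R \ B_r` (i.e. disjoint from the circle `|z| = R`),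
then `‖ζ‖₂ ≤ ‖dζ‖₁`. -/
theorem stmt5 (k : ℕ) (hk : 1 ≤ k) (R r : ℝ) (hR : 0 < R) (hr : r ∈ Set.Ico 0 R)
    (ζ : EuclideanSpace ℝ (Fin 2) → EuclideanSpace ℝ (Fin k))
    (hζ : ContDiffOn ℝ (⊤ : ℕ∞) ζ (annulus R r))
    (hsupp : closure {z | z ∈ annulus R r ∧ ζ z ≠ 0} ⊆
      Metric.ball 0 R \ Metric.ball 0 r) :
    eLpNorm ζ 2 (volume.restrict (annulus R r)) ≤
      eLpNorm (fun y => fderiv ℝ ζ y) 1 (volume.restrict (annulus R r)) := by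
  have hA : MeasurableSet (annulus R r) := (isOpen_annulus R r).measurableSet
  set g : EuclideanSpace ℝ (Fin 2) → ENNReal :=
    (annulus R r).indicator (fun y => ‖fderiv ℝ ζ y‖ₑ) with hg
  have hgm : Measurable g := (measurable_fderiv ℝ ζ).enorm.indicator hA
  have hmk : Measurable fun p : ℝ × ℝ => !₂[p.1, p.2] := by
    have : Continuous fun p : ℝ × ℝ => !₂[p.1, p.2] := by fun_prop
    exact this.measurable
  have hGm : Measurable fun p : ℝ × ℝ => g !₂[p.1, p.2] := hgm.comp hmk
  have hx (x y : ℝ) (hz : !₂[x, y] ∈ annulus R r) : ‖ζ !₂[x, y]‖ₑ ≤ ∫⁻ s, g !₂[s, y] := by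
    rw [← lintegral_add_left_eq_self _ x]
    refine (enorm_le_lintegral_line hζ hsupp hz (v := !₂[1, 0])
      (by simp [EuclideanSpace.norm_eq])).trans_eq ?_
    congr! 3 with t
    ext i
    fin_cases i <;> simp
  have hy (x y : ℝ) (hz : !₂[x, y] ∈ annulus R r) : ‖ζ !₂[x, y]‖ₑ ≤ ∫⁻ s, g !₂[x, s] := by
    rw [← lintegral_add_left_eq_self _ y]
    refine (enorm_le_lintegral_line hζ hsupp hz (v := !₂[0, 1])
      (by simp [EuclideanSpace.norm_eq])).trans_eq ?_
    congr! 3 with t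
    ext i
    fin_cases i <;> simp
  have hrhs : eLpNorm (fun y => fderiv ℝ ζ y) 1 (volume.restrict (annulus R r)) = ∫⁻ z, g z := by
    rw [eLpNorm_one_eq_lintegral_enorm, hg, lintegral_indicator hA]
  have hsq : ∫⁻ z in annulus R r, ‖ζ z‖ₑ ^ 2 ≤ (∫⁻ z, g z) ^ 2 := by
    rw [← lintegral_indicator hA, lintegral_euclideanSpace_fin_two,
      lintegral_euclideanSpace_fin_two g]
    calc ∫⁻ p : ℝ × ℝ, (annulus R r).indicator (fun z => ‖ζ z‖ₑ ^ 2) !₂[p.1, p.2]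
        ≤ ∫⁻ p : ℝ × ℝ, (∫⁻ s, g !₂[p.1, s]) * ∫⁻ s, g !₂[s, p.2] := by
          refine lintegral_mono fun p => ?_
          by_cases hp : !₂[p.1, p.2] ∈ annulus R r
          · rw [Set.indicator_of_mem hp, sq]
            exact mul_le_mul' (hy _ _ hp) (hx _ _ hp)
          · rw [Set.indicator_of_notMem hp]
            exact zero_le
      _ = (∫⁻ x, ∫⁻ s, g !₂[x, s]) * ∫⁻ y, ∫⁻ s, g !₂[s, y] :=
          lintegral_prod_mul hGm.lintegral_prod_right'.aemeasurable
            hGm.lintegral_prod_left'.aemeasurable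
      _ = (∫⁻ p : ℝ × ℝ, g !₂[p.1, p.2]) ^ 2 := by
          rw [sq, Measure.volume_eq_prod]
          congr 1
          · exact (lintegral_prod _ hGm.aemeasurable).symm
          · exact (lintegral_prod_symm _ hGm.aemeasurable).symm
  rw [hrhs, eLpNorm_eq_lintegral_rpow_enorm_toReal (by norm_num) (by norm_num)]
  simp only [ENNReal.toReal_ofNat, ENNReal.rpow_ofNat]
  rw [one_div, ENNReal.rpow_inv_le_iff (by norm_num), ENNReal.rpow_ofNat]
  exact hsq
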